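/- Let x₁, x₂, x₃, x₄ be four distinct unit vectors in ℝ³ whose pairwise spherical distances d(x,y) = arccos⟨x,y⟩ satisfy d(x_i,x_j) ≤ M < π/2 for all i,j, and suppose x₃ lies on a minimal geodesic from x₂ to x₄ with d(x₃,x₄) = t·d(x₂,x₄), where t ∈ (0,1). Then sin²(d(x₁,x₃)/2) ≤ (sin((1−t)M)/sin M)·sin²(d(x₁,x₄)/2) + (sin(tM)/sin M)·(max{cos d(x₂,x₄) − cos d(x₂,x₁), 0})/2 + sin²(tM/2). -/

import Mathlib

open Real RealInnerProductSpace

/-- The spherical distance between two (unit) vectors of Euclidean `ℝ³`. -/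
noncomputable def sphDist (x y : EuclideanSpace ℝ (Fin 3)) : ℝ :=
  Real.arccos ⟪x, y⟫

theorem aux_nonneg (s : ℝ) (hs0 : 0 < s) (hs1 : s < 1) (x : ℝ) (hx0 : 0 ≤ x) (hx : x ≤ π / 2) :
    0 ≤ s * Real.cos (s * x) * Real.sin x - Real.sin (s * x) * Real.cos x := by
  have hd : ∀ y : ℝ, HasDerivAt
      (fun y : ℝ => s * Real.cos (s * y) * Real.sin y - Real.sin (s * y) * Real.cos y)
      ((1 - s ^ 2) * (Real.sin (s * y) * Real.sin y)) y := by
    intro y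
    have hl : HasDerivAt (fun y : ℝ => s * y) s y := by
      simpa using (hasDerivAt_id y).const_mul s
    have h1 := ((hl.cos.const_mul s).mul (Real.hasDerivAt_sin y)).sub
      (hl.sin.mul (Real.hasDerivAt_cos y))
    refine h1.congr_deriv ?_
    ring
  have hm : MonotoneOn
      (fun y : ℝ => s * Real.cos (s * y) * Real.sin y - Real.sin (s * y) * Real.cos y)
      (Set.Icc 0 (π / 2)) := by
    apply monotoneOn_of_deriv_nonneg (convex_Icc _ _)
    · exact fun y _ => (hd y).continuousAt.continuousWithinAt
    · exact fun y _ => (hd y).differentiableAt.differentiableWithinAt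
    · intro y hy
      rw [interior_Icc] at hy
      rw [(hd y).deriv]
      have h1 : 0 ≤ Real.sin y := Real.sin_nonneg_of_nonneg_of_le_pi hy.1.le (by linarith [hy.2, Real.pi_pos])
      have h2 : 0 ≤ Real.sin (s * y) :=
        Real.sin_nonneg_of_nonneg_of_le_pi (by nlinarith [hy.1]) (by nlinarith [hy.1, hy.2, Real.pi_pos])
      have h3 : 0 ≤ 1 - s ^ 2 := by nlinarith
      positivity
  have := hm (a := 0) (b := x) ⟨le_rfl, by positivity⟩ ⟨hx0, hx⟩ hx0
  simpa using this

theorem aux_ratio (s D M : ℝ) (hs0 : 0 < s) (hs1 : s < 1) (hD : 0 < D) (hDM : D ≤ M)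
    (hM : M < π / 2) :
    Real.sin (s * D) / Real.sin D ≤ Real.sin (s * M) / Real.sin M := by
  have hpos : ∀ y ∈ Set.Icc D M, 0 < Real.sin y := fun y hy =>
    Real.sin_pos_of_pos_of_lt_pi (by linarith [hy.1]) (by linarith [hy.2, Real.pi_pos])
  have hd : ∀ y ∈ Set.Icc D M, HasDerivAt
      (fun y : ℝ => Real.sin (s * y) / Real.sin y)
      ((s * Real.cos (s * y) * Real.sin y - Real.sin (s * y) * Real.cos y) / Real.sin y ^ 2) y := by
    intro y hy
    have hl : HasDerivAt (fun y : ℝ => s * y) s y := by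
      simpa using (hasDerivAt_id y).const_mul s
    refine (hl.sin.div (Real.hasDerivAt_sin y) (hpos y hy).ne').congr_deriv ?_
    ring
  have hm : MonotoneOn (fun y : ℝ => Real.sin (s * y) / Real.sin y) (Set.Icc D M) := by
    apply monotoneOn_of_deriv_nonneg (convex_Icc _ _)
    · exact fun y hy => (hd y hy).continuousAt.continuousWithinAt
    · exact fun y hy => (hd y (interior_subset hy)).differentiableAt.differentiableWithinAt
    · intro y hy
      have hy := interior_subset hy
      rw [(hd y hy).deriv]
      exact div_nonneg (aux_nonneg s hs0 hs1 y (by linarith [hy.1]) (by linarith [hy.2]))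
        (sq_nonneg _)
  exact hm ⟨le_rfl, hDM⟩ ⟨hDM, le_rfl⟩ hDM

theorem cos_sphDist (x y : EuclideanSpace ℝ (Fin 3)) (hx : ‖x‖ = 1) (hy : ‖y‖ = 1) :
    Real.cos (sphDist x y) = ⟪x, y⟫ := by
  have h := abs_le.mp (abs_real_inner_le_norm x y)
  rw [hx, hy] at h
  exact Real.cos_arccos (by linarith [h.1]) (by linarith [h.2])

theorem sin_half_sq (x : ℝ) : Real.sin (x / 2) ^ 2 = (1 - Real.cos x) / 2 := by
  have h := Real.cos_sq (x / 2)
  rw [show 2 * (x / 2) = x by ring] at h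
  have := Real.sin_sq_add_cos_sq (x / 2)
  linarith

/-- Lemma 3.3: a refined estimate for `sin²(d(x₁,x₃)/2)` when `x₃` lies on a minimal geodesic
from `x₂` to `x₄` with `d(x₃,x₄) = t·d(x₂,x₄)` and all pairwise distances are at most
`M < π/2`. -/
theorem sph_refined_estimate (x₁ x₂ x₃ x₄ : EuclideanSpace ℝ (Fin 3)) (M t : ℝ)
    (h₁ : ‖x₁‖ = 1) (h₂ : ‖x₂‖ = 1) (h₃ : ‖x₃‖ = 1) (h₄ : ‖x₄‖ = 1)
    (h₁₂ : x₁ ≠ x₂) (h₁₃ : x₁ ≠ x₃) (h₁₄ : x₁ ≠ x₄)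
    (h₂₃ : x₂ ≠ x₃) (h₂₄ : x₂ ≠ x₄) (h₃₄ : x₃ ≠ x₄)
    (hMpi : M < π / 2)
    (hd₁₂ : sphDist x₁ x₂ ≤ M) (hd₁₃ : sphDist x₁ x₃ ≤ M) (hd₁₄ : sphDist x₁ x₄ ≤ M)
    (hd₂₃ : sphDist x₂ x₃ ≤ M) (hd₂₄ : sphDist x₂ x₄ ≤ M) (hd₃₄ : sphDist x₃ x₄ ≤ M)
    (ht : t ∈ Set.Ioo (0 : ℝ) 1)
    (hbetween : sphDist x₂ x₃ + sphDist x₃ x₄ = sphDist x₂ x₄)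
    (hratio : sphDist x₃ x₄ = t * sphDist x₂ x₄) :
    Real.sin (sphDist x₁ x₃ / 2) ^ 2 ≤
      (Real.sin ((1 - t) * M) / Real.sin M) * Real.sin (sphDist x₁ x₄ / 2) ^ 2 +
        (Real.sin (t * M) / Real.sin M) *
          (max (Real.cos (sphDist x₂ x₄) - Real.cos (sphDist x₂ x₁)) 0 / 2) +
        Real.sin (t * M / 2) ^ 2 := by
  obtain ⟨ht0, ht1⟩ := ht
  have c12 := cos_sphDist x₂ x₁ h₂ h₁
  have c13 := cos_sphDist x₁ x₃ h₁ h₃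
  have c14 := cos_sphDist x₁ x₄ h₁ h₄
  have c23 := cos_sphDist x₂ x₃ h₂ h₃
  have c24 := cos_sphDist x₂ x₄ h₂ h₄
  have c34 := cos_sphDist x₃ x₄ h₃ h₄
  have e23 : sphDist x₂ x₃ = (1 - t) * sphDist x₂ x₄ := by linarith
  rw [e23] at c23
  rw [hratio] at c34
  have hD : 0 < sphDist x₂ x₄ := by
    refine lt_of_le_of_ne (Real.arccos_nonneg _) fun h => h₂₄ ?_
    rw [← h, Real.cos_zero] at c24
    exact (inner_eq_one_iff_of_norm_eq_one h₂ h₄).mp c24.symm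
  rw [sin_half_sq, sin_half_sq, sin_half_sq, c13, c14, c12]
  clear hratio hbetween e23
  generalize sphDist x₂ x₄ = D at *
  have hS : 0 < Real.sin D := Real.sin_pos_of_pos_of_lt_pi hD (by linarith [Real.pi_pos])
  have hSM : 0 < Real.sin M := Real.sin_pos_of_pos_of_lt_pi (by linarith) (by linarith [Real.pi_pos])
  have eD : D = t * D + (1 - t) * D := by ring
  have sD : Real.sin D = Real.sin (t * D) * Real.cos ((1 - t) * D)
      + Real.cos (t * D) * Real.sin ((1 - t) * D) := by
    rw [← Real.sin_add, ← eD]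
  have cD : Real.cos D = Real.cos (t * D) * Real.cos ((1 - t) * D)
      - Real.sin (t * D) * Real.sin ((1 - t) * D) := by
    rw [← Real.cos_add, ← eD]
  have pu := Real.sin_sq_add_cos_sq (t * D)
  have pv := Real.sin_sq_add_cos_sq ((1 - t) * D)
  have key : Real.sin D • x₃ - (Real.sin (t * D) • x₂ + Real.sin ((1 - t) * D) • x₄) = 0 := by
    rw [← norm_eq_zero, ← sq_eq_zero_iff, norm_sub_sq_real, norm_add_sq_real]
    simp only [norm_smul, inner_add_right, inner_smul_left, inner_smul_right, h₂, h₃, h₄,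
      mul_one, Real.norm_eq_abs, sq_abs, real_inner_comm x₂ x₃, conj_trivial]
    rw [← c34, ← c24]
    rw [real_inner_comm] at c23
    first | rw [← c23] | rw [real_inner_comm, ← c23]
    rw [sD, cD]
    grind
  have key2 : Real.sin D * ⟪x₁, x₃⟫ = Real.sin (t * D) * ⟪x₂, x₁⟫
      + Real.sin ((1 - t) * D) * ⟪x₁, x₄⟫ := by
    have := congrArg (fun z => ⟪x₁, z⟫) (sub_eq_zero.mp key)
    simpa [inner_add_right, inner_smul_right, real_inner_comm x₂ x₁] using this
  have hb := aux_ratio t D M ht0 ht1 hD hd₂₄ hMpi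
  have ha := aux_ratio (1 - t) D M (by linarith) (by linarith) hD hd₂₄ hMpi
  have hb0 : 0 ≤ Real.sin (t * D) / Real.sin D :=
    div_nonneg (Real.sin_nonneg_of_nonneg_of_le_pi (by positivity) (by nlinarith [Real.pi_pos])) hS.le
  have hlast : Real.cos (t * M) ≤ Real.cos (t * D) :=
    Real.cos_le_cos_of_nonneg_of_le_pi (by positivity) (by nlinarith [Real.pi_pos]) (by nlinarith)
  have h14 : ⟪x₁, x₄⟫ ≤ 1 := by rw [← c14]; exact Real.cos_le_one _
  have e1 : ⟪x₁, x₃⟫ = Real.sin (t * D) / Real.sin D * ⟪x₂, x₁⟫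
      + Real.sin ((1 - t) * D) / Real.sin D * ⟪x₁, x₄⟫ := by
    rw [div_mul_eq_mul_div, div_mul_eq_mul_div, ← add_div, eq_div_iff hS.ne']
    linarith
  have e2 : Real.sin ((1 - t) * D) / Real.sin D + Real.sin (t * D) / Real.sin D * Real.cos D
      = Real.cos (t * D) := by
    field_simp
    rw [sD, cD]
    grind
  rw [e1]
  generalize Real.sin (t * D) / Real.sin D = b at *
  generalize Real.sin ((1 - t) * D) / Real.sin D = a at *
  have m1 := mul_le_mul_of_nonneg_right ha (sub_nonneg.mpr h14)
  have m2 := mul_le_mul_of_nonneg_right hb (le_max_right (Real.cos D - ⟪x₂, x₁⟫) 0)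
  have m3 := mul_le_mul_of_nonneg_left (le_max_left (Real.cos D - ⟪x₂, x₁⟫) 0) hb0
  linarith
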